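/- arXiv:2204.00615 — 2 statements merged into one kernel-verified Lean document; each statement's English description precedes it below -/
import Mathlib

section
/- Let k be a positive integer and let f ∈ 𝒫̃_k. Then −log k − 1/k ≤ B_f ≤ −1. Moreover, the lower bound is attained if and only if f(x) = min{1 + 1/k − x, 1} for all x ∈ [0,1], and the upper bound is attained if and only if f(x) = 1 for all x ∈ [0,1]. -/
open Filter Set

/-- `IsPWith f m ρ` : `f` belongs to the class `𝒫` with witness breakpoints
`0 = ρ_0 < ρ_1 < ⋯ < ρ_{m+1} = 1` (rational). -/
def IsPWith (f : ℝ → ℝ) (m : ℕ) (ρ : ℕ → ℚ) : Prop :=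
  (∀ x ∈ Set.Icc (0:ℝ) 1, f x ∈ Set.Icc (0:ℝ) 1) ∧
  (∀ x y : ℝ, 0 ≤ x → x ≤ y → y ≤ 1 → f y ≤ f x) ∧
  ρ 0 = 0 ∧ ρ (m + 1) = 1 ∧
  (∀ i j : ℕ, i < j → j ≤ m + 1 → ρ i < ρ j) ∧
  (∀ i : ℕ, 1 ≤ i → i ≤ m + 1 → ∃ a b : ℝ,
    ∀ x ∈ Set.Ioo ((ρ (i - 1) : ℝ)) ((ρ i : ℝ)), f x = a * x + b) ∧
  (∃ ε > (0:ℝ), ∀ x : ℝ, 0 ≤ x → x < ε → f x = 1) ∧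
  0 < f 1 ∧
  (∀ a ∈ Set.Ioo (0:ℝ) 1, ∃ L : ℝ,
    Filter.Tendsto f (nhdsWithin a (Set.Ioi a)) (nhds L) ∧ 1 - a < L)

/-- `f` belongs to the class `𝒫`. -/
def IsP (f : ℝ → ℝ) : Prop := ∃ (m : ℕ) (ρ : ℕ → ℚ), IsPWith f m ρ

/-- `f` belongs to the class `𝒫̃_k` : `f ∈ 𝒫`, `k·f(i/k) ∈ ℤ` for `i ∈ {1,…,k}`,
`f` is upper semicontinuous on `[0,1]`, and on each `((i-1)/k, i/k)` the function
`f` is affine with non-positive integer slope. -/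
def IsPtilde (k : ℕ) (f : ℝ → ℝ) : Prop :=
  IsP f ∧
  (∀ i : ℕ, 1 ≤ i → i ≤ k → ∃ z : ℤ, (k : ℝ) * f ((i : ℝ) / (k : ℝ)) = (z : ℝ)) ∧
  UpperSemicontinuousOn f (Set.Icc (0:ℝ) 1) ∧
  (∀ i : ℕ, 1 ≤ i → i ≤ k → ∃ (s : ℤ) (b : ℝ), s ≤ 0 ∧
    ∀ x ∈ Set.Ioo (((i : ℝ) - 1) / (k : ℝ)) ((i : ℝ) / (k : ℝ)),
      f x = (s : ℝ) * x + b)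

open MeasureTheory in
/-- A property holding almost everywhere on `(0, 1]` holds somewhere in every nonempty open
subinterval. -/
lemma exists_mem_Ioo_of_ae_restrict_Ioc {p : ℝ → Prop}
    (h : ∀ᵐ x ∂(volume.restrict (Ioc (0:ℝ) 1)), p x)
    {a b : ℝ} (ha : 0 ≤ a) (hb : b ≤ 1) (hab : a < b) : ∃ x ∈ Ioo a b, p x := by
  have h1 := ae_restrict_of_ae_restrict_of_subset
    (fun x (hx : x ∈ Ioo a b) => (⟨ha.trans_lt hx.1, hx.2.le.trans hb⟩ : x ∈ Ioc (0:ℝ) 1)) h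
  by_contra! hc
  have h2 : ∀ᵐ x ∂(volume.restrict (Ioo a b)), False := by
    filter_upwards [h1, ae_restrict_mem measurableSet_Ioo] with x hx hm using hc x hm hx
  rw [ae_iff] at h2
  simp at h2
  linarith

/-- An antitone upper semicontinuous function which is affine on `(a, c)` agrees with its affine
formula at `c`. -/
lemma eq_affine_right_endpoint {f : ℝ → ℝ}
    (hanti : ∀ x y : ℝ, 0 ≤ x → x ≤ y → y ≤ 1 → f y ≤ f x)
    (husc : UpperSemicontinuousOn f (Icc (0:ℝ) 1)) {a c s b : ℝ} (ha : 0 ≤ a) (hac : a < c)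
    (hc : c ≤ 1) (haff : ∀ x ∈ Ioo a c, f x = s * x + b) : f c = s * c + b := by
  have ht : Tendsto (fun x : ℝ => s * x + b) (nhdsWithin c (Iio c)) (nhds (s * c + b)) :=
    ((by fun_prop : Continuous fun x : ℝ => s * x + b).tendsto c).mono_left nhdsWithin_le_nhds
  have hm : Ioo a c ∈ nhdsWithin c (Iio c) := Ioo_mem_nhdsLT hac
  apply le_antisymm
  · refine ge_of_tendsto ht ?_
    filter_upwards [hm] with x hx
    rw [← haff x hx]
    exact hanti x c (ha.trans hx.1.le) hx.2.le hc
  · refine le_of_forall_gt_imp_ge_of_dense fun d hd => ?_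
    have h1 := husc c ⟨(ha.trans_lt hac).le, hc⟩ d hd
    have h2 : nhdsWithin c (Ioo a c) ≤ nhdsWithin c (Icc (0:ℝ) 1) :=
      nhdsWithin_mono _ fun x hx => ⟨ha.trans hx.1.le, hx.2.le.trans hc⟩
    rw [nhdsWithin_Ioo_eq_nhdsLT hac] at h2
    refine le_of_tendsto ht ?_
    filter_upwards [hm, h2 h1] with x hx h3
    rw [← haff x hx]
    exact h3.le

lemma inv_le_of_mul_eq_intCast {K y : ℝ} {z : ℤ} (hK : 0 < K) (hy : 0 < y) (h : K * y = z) :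
    1 / K ≤ y := by
  have h1 : (0:ℝ) < z := h ▸ mul_pos hK hy
  have h2 : (1:ℝ) ≤ z := by exact_mod_cast (Int.cast_pos.mp h1 : (0:ℤ) < z)
  rw [div_le_iff₀ hK]
  linarith

namespace IsPtilde

variable {k : ℕ} {f : ℝ → ℝ}

lemma eq_one_of_le (hk : 0 < k) (hf : IsPtilde k f) {x : ℝ} (hx0 : 0 ≤ x) (hx : x ≤ 1 / k) :
    f x = 1 := by
  obtain ⟨⟨m, ρ, hr, hanti, -, -, -, -, ⟨ε, hε, hone⟩, -, -⟩, -, husc, haff⟩ := hf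
  have hk0 : (0:ℝ) < k := by exact_mod_cast hk
  have hk1 : (1:ℝ) ≤ k := by exact_mod_cast hk
  have hik : (0:ℝ) < 1 / k := by positivity
  have hik1 : 1 / (k:ℝ) ≤ 1 := by rw [div_le_one hk0]; exact hk1
  obtain ⟨s, b, -, h⟩ := haff 1 le_rfl hk
  simp only [Nat.cast_one, sub_self, zero_div] at h
  have hmin : 0 < min ε (1 / (k:ℝ)) := lt_min hε hik
  have hm1 := min_le_left ε (1 / (k:ℝ))
  have hm2 := min_le_right ε (1 / (k:ℝ))
  have e1 := h (min ε (1 / (k:ℝ)) / 2) ⟨by linarith, by linarith⟩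
  have e2 := h (min ε (1 / (k:ℝ)) / 4) ⟨by linarith, by linarith⟩
  rw [hone _ (by linarith) (by linarith)] at e1 e2
  have hs : (s:ℝ) = 0 := by
    have : (s:ℝ) * (min ε (1 / (k:ℝ)) / 4) = 0 := by linarith
    rcases mul_eq_zero.mp this with h0 | h0
    · exact h0
    · linarith
  have hb : b = 1 := by rw [hs] at e1; linarith
  have hc := eq_affine_right_endpoint hanti husc le_rfl hik hik1 h
  rw [hs, hb, zero_mul, zero_add] at hc
  refine le_antisymm (hr x ⟨hx0, hx.trans hik1⟩).2 ?_
  rw [← hc]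
  exact hanti x _ hx0 hx hik1

lemma inv_le_add_sub_one (hk : 0 < k) (hf : IsPtilde k f) {x : ℝ} (hx : 1 / (k:ℝ) < x)
    (hx1 : x ≤ 1) : 1 / (k:ℝ) ≤ f x + x - 1 := by
  obtain ⟨⟨m, ρ, hr, hanti, -, -, -, -, -, hf1, hlim⟩, hint, husc, haff⟩ := hf
  have hk0 : (0:ℝ) < k := by exact_mod_cast hk
  set i := ⌈(k:ℝ) * x⌉₊ with hi
  have hx0 : 0 < x := lt_trans (by positivity) hx
  have hkx : 1 < (k:ℝ) * x := by
    rw [div_lt_iff₀ hk0] at hx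
    linarith
  have hi1 : (k:ℝ) * x ≤ i := Nat.le_ceil _
  have hi2 : (i:ℝ) < k * x + 1 := Nat.ceil_lt_add_one (by linarith)
  have hi3 : 1 < i := by exact_mod_cast hkx.trans_le hi1
  have hik : i ≤ k := Nat.ceil_le.mpr (by nlinarith)
  have hi3' : (1:ℝ) < i := by exact_mod_cast hi3
  have hik' : (i:ℝ) ≤ k := by exact_mod_cast hik
  obtain ⟨s, b, hs, h⟩ := haff i hi3.le hik
  obtain ⟨z, hz⟩ := hint i hi3.le hik
  have hc0 : (k:ℝ) * ((i:ℝ) / k) = i := by field_simp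
  have ha0 : (k:ℝ) * (((i:ℝ) - 1) / k) = i - 1 := by field_simp
  generalize hc : (i:ℝ) / k = c at *
  generalize ha : ((i:ℝ) - 1) / k = a at *
  have ha_pos : 0 < a := by rw [← ha]; exact div_pos (by linarith) hk0
  have hac : a < c := by nlinarith
  have hc1 : c ≤ 1 := by rw [← hc, div_le_one hk0]; exact hik'
  have hax : a < x := by nlinarith
  have hxc : x ≤ c := by nlinarith
  have hfc := eq_affine_right_endpoint hanti husc ha_pos.le hac hc1 h
  have hright : 1 / (k:ℝ) ≤ f c + c - 1 := by
    refine inv_le_of_mul_eq_intCast (z := z + i - k) hk0 ?_ (by push_cast; linarith)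
    rcases hc1.lt_or_eq with hlt | rfl
    · obtain ⟨L, hL, hL1⟩ := hlim c ⟨ha_pos.trans hac, hlt⟩
      have : L ≤ f c := by
        refine le_of_tendsto hL ?_
        filter_upwards [Ioo_mem_nhdsGT hlt] with y hy
        exact hanti c y (ha_pos.trans hac).le hy.1.le hy.2.le
      linarith
    · linarith
  have hleft : 1 / (k:ℝ) ≤ s * a + b + a - 1 := by
    refine inv_le_of_mul_eq_intCast (z := z - s + i - 1 - k) hk0 ?_ ?_
    · obtain ⟨L, hL, hL1⟩ := hlim a ⟨ha_pos, hac.trans_le hc1⟩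
      have ht : Tendsto (fun x : ℝ => (s:ℝ) * x + b) (nhdsWithin a (Ioi a))
          (nhds (s * a + b)) :=
        ((by fun_prop : Continuous fun x : ℝ => (s:ℝ) * x + b).tendsto a).mono_left
          nhdsWithin_le_nhds
      have heq : L = s * a + b := by
        refine tendsto_nhds_unique (hL.congr' ?_) ht
        filter_upwards [Ioo_mem_nhdsGT hac] with y hy using h y hy
      linarith
    · push_cast
      rw [← hz, hfc]
      linear_combination (1 + (s:ℝ)) * ha0 - (s:ℝ) * hc0
  have hfx : f x = s * x + b := by
    rcases hxc.lt_or_eq with hlt | rfl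
    · exact h x ⟨hax, hlt⟩
    · exact hfc
  rw [hfx]
  rcases hs.lt_or_eq with hneg | h0
  · have : (s:ℝ) ≤ -1 := by exact_mod_cast (by omega : s ≤ -1)
    nlinarith
  · rw [h0] at hleft ⊢
    push_cast at hleft ⊢
    linarith

lemma le_one (hf : IsPtilde k f) {x : ℝ} (hx : x ∈ Icc (0:ℝ) 1) : f x ≤ 1 := by
  obtain ⟨⟨m, ρ, hr, -⟩, -⟩ := hf
  exact (hr x hx).2

lemma antitoneOn (hf : IsPtilde k f) : AntitoneOn f (Icc (0:ℝ) 1) := by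
  obtain ⟨⟨m, ρ, -, hanti, -⟩, -⟩ := hf
  exact fun x hx y hy hxy => hanti x y hx.1 hxy hy.2

/-- The pointwise bounds on the integrand over `(0, 1]`. -/
lemma log_bounds (hk : 0 < k) (hf : IsPtilde k f) {x : ℝ} (hx : x ∈ Ioc (0:ℝ) 1) :
    Real.log (min x (1 / k)) ≤ Real.log (f x + x - 1) ∧
      Real.log (f x + x - 1) ≤ Real.log x := by
  have hk0 : (0:ℝ) < 1 / k := by positivity
  have hx0 := hx.1
  have h2 := hf.le_one ⟨hx.1.le, hx.2⟩
  have h1 : min x (1 / (k:ℝ)) ≤ f x + x - 1 := by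
    rcases le_or_gt x (1 / (k:ℝ)) with h | h
    · rw [hf.eq_one_of_le hk hx.1.le h]
      linarith [min_le_left x (1 / (k:ℝ))]
    · exact (min_le_right _ _).trans (hf.inv_le_add_sub_one hk h hx.2)
  have h3 : 0 < min x (1 / (k:ℝ)) := lt_min hx.1 hk0
  exact ⟨Real.log_le_log h3 h1, Real.log_le_log (h3.trans_le h1) (by linarith)⟩

end IsPtilde

open MeasureTheory

lemma intervalIntegrable_log_min {c : ℝ} (hc : 0 < c) (a b : ℝ) (ha : 0 ≤ a) (hb : 0 ≤ b) :
    IntervalIntegrable (fun x => Real.log (min x c)) volume a b := by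
  have h : IntervalIntegrable (fun x => min (Real.log x) (Real.log c)) volume a b :=
    ⟨intervalIntegral.intervalIntegrable_log'.1.inf intervalIntegrable_const.1,
      intervalIntegral.intervalIntegrable_log'.2.inf intervalIntegrable_const.2⟩
  refine h.congr fun x hx => ?_
  have hx0 : 0 < x := (le_min ha hb).trans_lt hx.1
  change min (Real.log x) (Real.log c) = Real.log (min x c)
  rcases le_total x c with h | h
  · rw [min_eq_left h, min_eq_left (Real.log_le_log hx0 h)]
  · rw [min_eq_right h, min_eq_right (Real.log_le_log hc h)]

lemma integral_log_min {c : ℝ} (hc : 0 < c) (hc1 : c ≤ 1) :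
    ∫ x in (0:ℝ)..1, Real.log (min x c) = Real.log c - c := by
  rw [← intervalIntegral.integral_add_adjacent_intervals
    (intervalIntegrable_log_min hc 0 c le_rfl hc.le)
    (intervalIntegrable_log_min hc c 1 hc.le zero_le_one)]
  have h1 : ∫ x in (0:ℝ)..c, Real.log (min x c) = ∫ x in (0:ℝ)..c, Real.log x := by
    refine intervalIntegral.integral_congr fun x hx => ?_
    rw [uIcc_of_le hc.le] at hx
    simp only [min_eq_left hx.2]
  have h2 : ∫ x in c..1, Real.log (min x c) = ∫ x in c..1, Real.log c := by
    refine intervalIntegral.integral_congr fun x hx => ?_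
    rw [uIcc_of_le hc1] at hx
    simp only [min_eq_right hx.1]
  rw [h1, h2, integral_log, intervalIntegral.integral_const, smul_eq_mul]
  simp
  ring

lemma IsPtilde.intervalIntegrable_log {k : ℕ} {f : ℝ → ℝ} (hk : 0 < k) (hf : IsPtilde k f) :
    IntervalIntegrable (fun x => Real.log (f x + x - 1)) volume 0 1 := by
  have hlog := intervalIntegrable_log_min (c := 1 / (k:ℝ)) (by positivity) 0 1 le_rfl zero_le_one
  refine hlog.mono_fun ?_ ?_
  · rw [uIoc_of_le zero_le_one]
    have h1 : AEMeasurable f (volume.restrict (Ioc (0:ℝ) 1)) :=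
      (aemeasurable_restrict_of_antitoneOn measurableSet_Icc hf.antitoneOn).mono_measure
        (Measure.restrict_mono Ioc_subset_Icc_self le_rfl)
    exact (Real.measurable_log.comp_aemeasurable
      ((h1.add aemeasurable_id).sub_const 1)).aestronglyMeasurable
  · rw [uIoc_of_le zero_le_one]
    filter_upwards [ae_restrict_mem measurableSet_Ioc] with x hx
    obtain ⟨h1, h2⟩ := hf.log_bounds hk hx
    have h3 := Real.log_nonpos hx.1.le hx.2
    rw [Real.norm_of_nonpos (by linarith), Real.norm_of_nonpos (by linarith)]
    linarith

/-- Pointwise ordered integrands on `(0, 1]` with equal integrals agree almost everywhere. -/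
lemma ae_eq_of_intervalIntegral_eq {u v : ℝ → ℝ} (hu : IntervalIntegrable u volume 0 1)
    (hv : IntervalIntegrable v volume 0 1) (huv : ∀ x ∈ Ioc (0:ℝ) 1, u x ≤ v x)
    (h : ∫ x in (0:ℝ)..1, u x = ∫ x in (0:ℝ)..1, v x) :
    ∀ᵐ x ∂(volume.restrict (Ioc (0:ℝ) 1)), u x = v x := by
  rw [intervalIntegral.integral_of_le zero_le_one, intervalIntegral.integral_of_le zero_le_one]
    at h
  have hle : u ≤ᵐ[volume.restrict (Ioc (0:ℝ) 1)] v := by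
    filter_upwards [ae_restrict_mem measurableSet_Ioc] with x hx using huv x hx
  exact (integral_eq_iff_of_ae_le hu.1 hv.1 hle).mp h

/-- for a positive integer `k` and `f ∈ 𝒫̃_k`, with
`B_f = lim_{ε↘0} ∫_ε^1 log(f(x)+x-1) dx`, we have
`-log k - 1/k ≤ B_f ≤ -1`; the lower bound is attained iff
`f(x) = min(1 + 1/k - x, 1)` on `[0,1]`, and the upper bound is attained iff
`f(x) = 1` on `[0,1]`. -/
theorem stmt11 (k : ℕ) (hk : 0 < k) (f : ℝ → ℝ) (hf : IsPtilde k f) (B : ℝ)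
    (hB : Filter.Tendsto (fun ε : ℝ => ∫ x in ε..1, Real.log (f x + x - 1))
      (nhdsWithin 0 (Set.Ioi 0)) (nhds B)) :
    (-Real.log k - 1 / k ≤ B ∧ B ≤ -1) ∧
    (B = -Real.log k - 1 / k ↔
      ∀ x ∈ Set.Icc (0:ℝ) 1, f x = min (1 + 1 / (k : ℝ) - x) 1) ∧
    (B = -1 ↔ ∀ x ∈ Set.Icc (0:ℝ) 1, f x = 1) := by
  have hk0 : (0:ℝ) < k := by exact_mod_cast hk
  have hk1 : (1:ℝ) ≤ k := by exact_mod_cast hk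
  have hc0 : (0:ℝ) < 1 / k := by positivity
  have hc1 : 1 / (k:ℝ) ≤ 1 := by rw [div_le_one hk0]; exact hk1
  have hg := hf.intervalIntegrable_log hk
  have hlog : IntervalIntegrable Real.log volume 0 1 := intervalIntegral.intervalIntegrable_log'
  have hmin := intervalIntegrable_log_min hc0 0 1 le_rfl zero_le_one
  have hImin : ∫ x in (0:ℝ)..1, Real.log (min x (1 / k)) = -Real.log k - 1 / k := by
    rw [integral_log_min hc0 hc1, one_div, Real.log_inv]
  have hIlog : ∫ x in (0:ℝ)..1, Real.log x = -1 := by simp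
  have hBeq : B = ∫ x in (0:ℝ)..1, Real.log (f x + x - 1) := by
    refine tendsto_nhds_unique hB ?_
    have hcont := intervalIntegral.continuousOn_primitive_interval_left
      (f := fun x => Real.log (f x + x - 1)) (μ := volume) (a := 0) (b := 1)
      (by rw [uIcc_of_le zero_le_one, integrableOn_Icc_iff_integrableOn_Ioc]; exact hg.1)
    rw [uIcc_of_le zero_le_one] at hcont
    have h1 := hcont 0 ⟨le_rfl, zero_le_one⟩
    refine h1.mono_left ?_
    rw [← nhdsWithin_Ioo_eq_nhdsGT (zero_lt_one' ℝ)]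
    exact nhdsWithin_mono _ Ioo_subset_Icc_self
  have hlow : ∀ x ∈ Ioc (0:ℝ) 1, Real.log (min x (1 / k)) ≤ Real.log (f x + x - 1) :=
    fun x hx => (hf.log_bounds hk hx).1
  have hupp : ∀ x ∈ Ioc (0:ℝ) 1, Real.log (f x + x - 1) ≤ Real.log x :=
    fun x hx => (hf.log_bounds hk hx).2
  have hpos : ∀ x ∈ Ioc (0:ℝ) 1, 0 < f x + x - 1 := fun x hx => by
    rcases le_or_gt x (1 / (k:ℝ)) with h | h
    · rw [hf.eq_one_of_le hk hx.1.le h]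
      linarith [hx.1]
    · exact hc0.trans_le (hf.inv_le_add_sub_one hk h hx.2)
  refine ⟨⟨?_, ?_⟩, ⟨fun h => ?_, fun h => ?_⟩, ⟨fun h => ?_, fun h => ?_⟩⟩
  · rw [hBeq, ← hImin]
    exact intervalIntegral.integral_mono_on_of_le_Ioo zero_le_one hmin hg
      fun x hx => hlow x ⟨hx.1, hx.2.le⟩
  · rw [hBeq, ← hIlog]
    exact intervalIntegral.integral_mono_on_of_le_Ioo zero_le_one hg hlog
      fun x hx => hupp x ⟨hx.1, hx.2.le⟩
  · have hae := ae_eq_of_intervalIntegral_eq hmin hg hlow (by rw [hImin, ← h, hBeq])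
    intro x hx
    rcases le_or_gt x (1 / (k:ℝ)) with hxk | hxk
    · rw [hf.eq_one_of_le hk hx.1 hxk, min_eq_right (by linarith)]
    rw [min_eq_left (by linarith)]
    refine le_antisymm ?_ (by linarith [hf.inv_le_add_sub_one hk hxk hx.2])
    by_contra! hlt
    obtain ⟨y, hy, hye⟩ := exists_mem_Ioo_of_ae_restrict_Ioc hae
      (a := max (1 / (k:ℝ)) (1 + 1 / k - f x)) (b := x)
      (hc0.le.trans (le_max_left _ _)) hx.2 (max_lt hxk (by linarith))
    have hy1 := (le_max_left _ _).trans_lt hy.1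
    have hy2 := (le_max_right _ _).trans_lt hy.1
    have hy01 : y ∈ Ioc (0:ℝ) 1 := ⟨hc0.trans hy1, hy.2.le.trans hx.2⟩
    rw [min_eq_right hy1.le] at hye
    have heq := Real.log_injOn_pos hc0 (hpos y hy01) hye
    have hmono := hf.antitoneOn ⟨hy01.1.le, hy01.2⟩ hx hy.2.le
    linarith
  · rw [hBeq, ← hImin]
    refine intervalIntegral.integral_congr fun x hx => ?_
    rw [uIcc_of_le zero_le_one] at hx
    simp only [h x hx]
    congr 1
    rcases le_total x (1 / (k:ℝ)) with hxk | hxk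
    · rw [min_eq_left hxk, min_eq_right (by linarith)]
      ring
    · rw [min_eq_right hxk, min_eq_left (by linarith)]
      ring
  · have hae := ae_eq_of_intervalIntegral_eq hg hlog hupp (by rw [hIlog, ← h, hBeq])
    have hlt1 : ∀ x ∈ Ico (0:ℝ) 1, f x = 1 := fun x hx => by
      refine le_antisymm (hf.le_one ⟨hx.1, hx.2.le⟩) ?_
      obtain ⟨y, hy, hye⟩ := exists_mem_Ioo_of_ae_restrict_Ioc hae hx.1 le_rfl hx.2
      have hy01 : y ∈ Ioc (0:ℝ) 1 := ⟨hx.1.trans_lt hy.1, hy.2.le⟩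
      have heq := Real.log_injOn_pos (hpos y hy01) hy01.1 hye
      have hmono := hf.antitoneOn ⟨hx.1, hx.2.le⟩ ⟨hy01.1.le, hy01.2⟩ hy.1.le
      linarith
    intro x hx
    rcases hx.2.lt_or_eq with hx1 | rfl
    · exact hlt1 x ⟨hx.1, hx1⟩
    · have := eq_affine_right_endpoint (s := 0) (b := 1)
        (fun x y hx hxy hy => hf.antitoneOn ⟨hx, hxy.trans hy⟩ ⟨hx.trans hxy, hy⟩ hxy)
        hf.2.2.1 le_rfl zero_lt_one le_rfl
        (fun x hx => by rw [hlt1 x ⟨hx.1.le, hx.2⟩]; ring)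
      simpa using this
  · rw [hBeq, ← hIlog]
    refine intervalIntegral.integral_congr fun x hx => ?_
    rw [uIcc_of_le zero_le_one] at hx
    simp only [h x hx]
    congr 1
    ring
end

section
/- Let N ≥ 2 be an integer and let k be an integer with 2 ≤ k ≤ N+1. For π uniformly random in S_N, the variance of X_k(π) satisfies Var(X_k) < k²/(2N); that is, (1/N!)·∑_{π ∈ S_N} X_k(π)² − ( (1/N!)·∑_{π ∈ S_N} X_k(π) )² < k²/(2N), where (1/N!)·∑_{π ∈ S_N} X_k(π) = k(k−1)/(2N). -/
section PermutationStatistics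

open Finset

/-- The symmetric group is transitive on ordered pairs of distinct points. -/
theorem exists_perm_apply_pair {α : Type*} [DecidableEq α] {j j' a b : α} (hj : j ≠ j')
    (hab : a ≠ b) : ∃ σ : Equiv.Perm α, σ j = a ∧ σ j' = b := by
  refine ⟨Equiv.swap (Equiv.swap j a j') b * Equiv.swap j a, ?_, ?_⟩
  · have h : Equiv.swap j a j' ≠ a := by
      intro h
      rw [Equiv.swap_apply_eq_iff, Equiv.swap_apply_right] at h
      exact hj h.symm
    rw [Equiv.Perm.mul_apply, Equiv.swap_apply_left]
    exact Equiv.swap_apply_of_ne_of_ne h.symm hab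
  · rw [Equiv.Perm.mul_apply, Equiv.swap_apply_left]

theorem sum_offDiag_eq_sub {α : Type*} [Fintype α] [DecidableEq α] (f : α → α → ℝ) :
    ∑ p ∈ (univ : Finset α).offDiag, f p.1 p.2 = ∑ i, ∑ j, f i j - ∑ i, f i i := by
  have h := sum_union (disjoint_diag_offDiag (univ : Finset α)) (f := fun p => f p.1 p.2)
  rw [diag_union_offDiag, sum_product, sum_diag] at h
  simp only at h
  linarith

/-- The joint law of the images of two distinct points under a uniform permutation is uniform on
ordered pairs of distinct points. -/
theorem sum_perm_apply_pair {α : Type*} [Fintype α] [DecidableEq α] {i i' : α} (hi : i ≠ i')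
    (f : α → α → ℝ) :
    (Fintype.card α : ℝ) * ((Fintype.card α : ℝ) - 1) * ∑ π : Equiv.Perm α, f (π i) (π i')
      = (Fintype.card α).factorial * ∑ q ∈ (univ : Finset α).offDiag, f q.1 q.2 := by
  set c : ℝ := ∑ π : Equiv.Perm α, if π i = i ∧ π i' = i' then (1 : ℝ) else 0 with hc
  have hconst : ∀ q ∈ (univ : Finset α).offDiag,
      (∑ π : Equiv.Perm α, if π i = q.1 ∧ π i' = q.2 then (1 : ℝ) else 0) = c := by
    intro q hq
    obtain ⟨σ, h1, h2⟩ := exists_perm_apply_pair hi (mem_offDiag.1 hq).2.2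
    rw [hc]
    symm
    refine Fintype.sum_equiv (Equiv.mulLeft σ) _ _ fun π => ?_
    simp only [Equiv.coe_mulLeft, Equiv.Perm.mul_apply, ← h1, ← h2, EmbeddingLike.apply_eq_iff_eq]
  have key : ∀ g : α → α → ℝ, ∑ π : Equiv.Perm α, g (π i) (π i')
      = c * ∑ q ∈ (univ : Finset α).offDiag, g q.1 q.2 := by
    intro g
    have h : ∀ π : Equiv.Perm α, g (π i) (π i') = ∑ q ∈ (univ : Finset α).offDiag,
        (if π i = q.1 ∧ π i' = q.2 then (1 : ℝ) else 0) * g q.1 q.2 := by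
      intro π
      rw [sum_eq_single (π i, π i')]
      · simp
      · rintro ⟨a, b⟩ - hne
        rw [if_neg, zero_mul]
        rintro ⟨rfl, rfl⟩
        exact hne rfl
      · intro h
        exact absurd (mem_offDiag.2 ⟨mem_univ _, mem_univ _, π.injective.ne hi⟩) h
    simp_rw [h]
    rw [sum_comm, mul_sum]
    refine sum_congr rfl fun q hq => ?_
    rw [← sum_mul, hconst q hq]
  have htotal := key fun _ _ => 1
  rw [sum_offDiag_eq_sub (fun _ _ => (1 : ℝ))] at htotal
  simp only [sum_const, card_univ, nsmul_eq_mul, mul_one, Fintype.card_perm] at htotal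
  rw [key f, htotal]
  ring

theorem sum_perm_apply {α : Type*} [Fintype α] [DecidableEq α] [Nontrivial α] (i : α)
    (f : α → ℝ) :
    (Fintype.card α : ℝ) * ∑ π : Equiv.Perm α, f (π i)
      = (Fintype.card α).factorial * ∑ j, f j := by
  obtain ⟨i', hi⟩ := exists_ne i
  have h := sum_perm_apply_pair hi.symm fun j _ => f j
  rw [sum_offDiag_eq_sub (fun j _ => f j)] at h
  simp only [sum_const, card_univ, nsmul_eq_mul, ← mul_sum] at h
  have hcard : (1 : ℝ) < Fintype.card α := by exact_mod_cast Fintype.one_lt_card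
  have h0 : (Fintype.card α : ℝ) - 1 ≠ 0 := by linarith
  apply mul_left_cancel₀ h0
  linarith

/-- First moment of the permutation statistic `∑ i, a i (π i)`. -/
theorem sum_perm_sum_apply {α : Type*} [Fintype α] [DecidableEq α] [Nontrivial α]
    (a : α → α → ℝ) :
    (Fintype.card α : ℝ) * ∑ π : Equiv.Perm α, ∑ i, a i (π i)
      = (Fintype.card α).factorial * ∑ i, ∑ j, a i j := by
  rw [sum_comm, mul_sum, mul_sum]
  exact sum_congr rfl fun i _ => sum_perm_apply i (a i)

theorem sum_offDiag_offDiag_mul {α : Type*} [Fintype α] [DecidableEq α] (a : α → α → ℝ) :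
    ∑ p ∈ (univ : Finset α).offDiag, ∑ q ∈ (univ : Finset α).offDiag, a p.1 q.1 * a p.2 q.2
      = (∑ i, ∑ j, a i j) ^ 2 - ∑ i, (∑ j, a i j) ^ 2 - ∑ j, (∑ i, a i j) ^ 2
        + ∑ i, ∑ j, a i j ^ 2 := by
  have h : ∀ i i', ∑ q ∈ (univ : Finset α).offDiag, a i q.1 * a i' q.2
      = (∑ j, a i j) * (∑ j, a i' j) - ∑ j, a i j * a i' j := by
    intro i i'
    rw [sum_offDiag_eq_sub (fun j j' => a i j * a i' j'), sum_mul_sum]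
  simp_rw [h]
  rw [sum_offDiag_eq_sub
    (fun i i' => (∑ j, a i j) * (∑ j, a i' j) - ∑ j, a i j * a i' j)]
  simp only [sum_sub_distrib]
  have h1 : ∑ i, ∑ i', (∑ j, a i j) * (∑ j, a i' j) = (∑ i, ∑ j, a i j) ^ 2 := by
    rw [sq, sum_mul_sum]
  have h2 : ∑ i, ∑ i', ∑ j, a i j * a i' j = ∑ j, (∑ i, a i j) ^ 2 := by
    simp_rw [sq, sum_mul_sum]
    rw [sum_comm (s := univ) (t := univ) (f := fun j i => ∑ i', a i j * a i' j)]
    exact sum_congr rfl fun i _ => sum_comm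
  rw [h1, h2]
  simp only [sq]
  ring

/-- Second moment of the permutation statistic `∑ i, a i (π i)`. -/
theorem sum_perm_sum_apply_sq {α : Type*} [Fintype α] [DecidableEq α] [Nontrivial α]
    (a : α → α → ℝ) :
    (Fintype.card α : ℝ) * ((Fintype.card α : ℝ) - 1)
        * ∑ π : Equiv.Perm α, (∑ i, a i (π i)) ^ 2
      = (Fintype.card α).factorial * ((∑ i, ∑ j, a i j) ^ 2 - ∑ i, (∑ j, a i j) ^ 2
        - ∑ j, (∑ i, a i j) ^ 2 + Fintype.card α * ∑ i, ∑ j, a i j ^ 2) := by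
  have h : ∀ π : Equiv.Perm α, (∑ i, a i (π i)) ^ 2
      = ∑ p ∈ (univ : Finset α).offDiag, a p.1 (π p.1) * a p.2 (π p.2)
        + ∑ i, a i (π i) ^ 2 := by
    intro π
    rw [sum_offDiag_eq_sub (fun i i' => a i (π i) * a i' (π i')), sq, sum_mul_sum]
    simp only [sq]
    ring
  have hpairs : (Fintype.card α : ℝ) * ((Fintype.card α : ℝ) - 1) * ∑ π : Equiv.Perm α,
      ∑ p ∈ (univ : Finset α).offDiag, a p.1 (π p.1) * a p.2 (π p.2)
      = (Fintype.card α).factorial * ∑ p ∈ (univ : Finset α).offDiag,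
        ∑ q ∈ (univ : Finset α).offDiag, a p.1 q.1 * a p.2 q.2 := by
    rw [sum_comm, mul_sum, mul_sum]
    exact sum_congr rfl fun p hp =>
      sum_perm_apply_pair (mem_offDiag.1 hp).2.2 fun j j' => a p.1 j * a p.2 j'
  have hdiag := sum_perm_sum_apply fun i j => a i j ^ 2
  simp_rw [h]
  rw [sum_offDiag_offDiag_mul] at hpairs
  rw [sum_add_distrib, mul_add, hpairs]
  linear_combination ((Fintype.card α : ℝ) - 1) * hdiag

theorem sum_range_tsub_cast (m N : ℕ) (h : m ≤ N) :
    ∑ i ∈ range N, ((m - i : ℕ) : ℝ) = m * (m + 1) / 2 := by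
  induction m generalizing N with
  | zero => simp
  | succ m ih =>
    obtain ⟨N, rfl⟩ : ∃ M, N = M + 1 := ⟨N - 1, by omega⟩
    rw [sum_range_succ']
    simp only [Nat.add_sub_add_right, ih N (by omega)]
    push_cast
    ring

theorem sum_range_tsub_cast_sq (m N : ℕ) (h : m ≤ N) :
    ∑ i ∈ range N, ((m - i : ℕ) : ℝ) ^ 2 = m * (m + 1) * (2 * m + 1) / 6 := by
  induction m generalizing N with
  | zero => simp
  | succ m ih =>
    obtain ⟨N, rfl⟩ : ∃ M, N = M + 1 := ⟨N - 1, by omega⟩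
    rw [sum_range_succ']
    simp only [Nat.add_sub_add_right, ih N (by omega)]
    push_cast
    ring

/-- Row sums of the indicator matrix of the staircase `(i + 1) + (j + 1) ≤ m + 1`. -/
theorem sum_staircase_row (N m : ℕ) (hm : m ≤ N) (i : ℕ) :
    ∑ j : Fin N, (if i + 1 + ((j : ℕ) + 1) ≤ m + 1 then (1 : ℝ) else 0) = ((m - i : ℕ) : ℝ) := by
  rw [Fin.sum_univ_eq_sum_range (fun j => if i + 1 + (j + 1) ≤ m + 1 then (1 : ℝ) else 0) N,
    sum_boole]
  congr 1
  rw [show (range N).filter (fun j => i + 1 + (j + 1) ≤ m + 1) = range (m - i) by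
    ext j
    simp only [mem_filter, mem_range]
    omega]
  exact card_range _

end PermutationStatistics

/-- let `N ≥ 2` and `2 ≤ k ≤ N+1`. With
`X_k(π) = #{i ∈ {1,…,N} : i + π(i) ≤ k}` (permutations encoded on `Fin N`, so
`i + π(i) ≤ k` reads `(i+1) + (π(i)+1) ≤ k`), for a uniformly random
permutation the mean of `X_k` is `k(k-1)/(2N)` and the variance satisfies
`Var(X_k) = (1/N!)·∑ X_k² - ((1/N!)·∑ X_k)² < k²/(2N)`. -/
theorem stmt18 (N k : ℕ) (hN : 2 ≤ N) (hk2 : 2 ≤ k) (hkN : k ≤ N + 1) :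
    (1 / (N.factorial : ℝ)) *
        ∑ π : Equiv.Perm (Fin N),
          ((Finset.univ.filter
              (fun i : Fin N => (i : ℕ) + 1 + ((π i : ℕ) + 1) ≤ k)).card : ℝ)
      = (k : ℝ) * ((k : ℝ) - 1) / (2 * (N : ℝ)) ∧
    (1 / (N.factorial : ℝ)) *
        ∑ π : Equiv.Perm (Fin N),
          ((Finset.univ.filter
              (fun i : Fin N => (i : ℕ) + 1 + ((π i : ℕ) + 1) ≤ k)).card : ℝ) ^ 2
      - ((1 / (N.factorial : ℝ)) *
          ∑ π : Equiv.Perm (Fin N),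
            ((Finset.univ.filter
                (fun i : Fin N => (i : ℕ) + 1 + ((π i : ℕ) + 1) ≤ k)).card : ℝ)) ^ 2
      < (k : ℝ) ^ 2 / (2 * (N : ℝ)) := by
  obtain ⟨m, rfl⟩ : ∃ m, k = m + 1 := ⟨k - 1, by omega⟩
  have hmN : m ≤ N := by omega
  have : Nontrivial (Fin N) := Fin.nontrivial_iff_two_le.2 hN
  set a : Fin N → Fin N → ℝ :=
    fun i j => if (i : ℕ) + 1 + ((j : ℕ) + 1) ≤ m + 1 then 1 else 0 with ha
  have hX : ∀ π : Equiv.Perm (Fin N),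
      ((Finset.univ.filter
        (fun i : Fin N => (i : ℕ) + 1 + ((π i : ℕ) + 1) ≤ m + 1)).card : ℝ)
      = ∑ i, a i (π i) := by
    intro π
    rw [ha, Finset.sum_boole]
  have hrow : ∀ i, ∑ j, a i j = ((m - (i : ℕ) : ℕ) : ℝ) :=
    fun i => sum_staircase_row N m hmN i
  have hcol : ∀ j, ∑ i, a i j = ((m - (j : ℕ) : ℕ) : ℝ) := by
    intro j
    rw [← sum_staircase_row N m hmN j]
    exact Finset.sum_congr rfl fun i _ => by rw [ha]; simp only [add_comm]
  have hidem : ∀ i j, a i j ^ 2 = a i j := by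
    intro i j
    simp only [ha]
    split_ifs <;> norm_num
  have hS : ∑ i : Fin N, ((m - (i : ℕ) : ℕ) : ℝ) = m * (m + 1) / 2 := by
    rw [Fin.sum_univ_eq_sum_range (fun i => ((m - i : ℕ) : ℝ)) N, sum_range_tsub_cast m N hmN]
  have hR : ∑ i : Fin N, ((m - (i : ℕ) : ℕ) : ℝ) ^ 2 = m * (m + 1) * (2 * m + 1) / 6 := by
    rw [Fin.sum_univ_eq_sum_range (fun i => ((m - i : ℕ) : ℝ) ^ 2) N,
      sum_range_tsub_cast_sq m N hmN]
  have hfirst := sum_perm_sum_apply a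
  have hsecond := sum_perm_sum_apply_sq a
  simp only [hidem, hrow, hcol, hS, hR, Fintype.card_fin] at hfirst hsecond
  simp_rw [hX]
  have hN2 : (2 : ℝ) ≤ N := by exact_mod_cast hN
  have hN0 : (0 : ℝ) < N := by linarith
  have hN1 : (0 : ℝ) < (N : ℝ) - 1 := by linarith
  have hm1 : (1 : ℝ) ≤ m := by exact_mod_cast (by omega : 1 ≤ m)
  have hmN' : (m : ℝ) ≤ N := by exact_mod_cast hmN
  have hF : (N.factorial : ℝ) ≠ 0 := by exact_mod_cast N.factorial_ne_zero
  have hmean : (1 / (N.factorial : ℝ)) * ∑ π : Equiv.Perm (Fin N), ∑ i, a i (π i)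
      = m * (m + 1) / (2 * N) := by
    field_simp
    linarith
  have hsq : (1 / (N.factorial : ℝ)) * ∑ π : Equiv.Perm (Fin N), (∑ i, a i (π i)) ^ 2
      = ((m * (m + 1) / 2 : ℝ) ^ 2 - m * (m + 1) * (2 * m + 1) / 6
        - m * (m + 1) * (2 * m + 1) / 6 + N * (m * (m + 1) / 2)) / (N * (N - 1)) := by
    rw [eq_div_iff (by positivity), one_div, mul_comm, ← mul_assoc, mul_comm _ _⁻¹]
    rw [mul_comm, eq_comm, ← mul_right_inj' hF, ← hsecond]
    field_simp
  rw [hmean, hsq]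
  push_cast
  refine ⟨by ring, ?_⟩
  have hpoly : 3 * ((m : ℝ) + 1) * m ^ 2 + 6 * (m + 1) * N < 6 * N ^ 2 + 4 * N * m * (2 * m + 1) := by
    have h1 : 3 * ((m : ℝ) + 1) * m * m ≤ 3 * (m + 1) * m * N :=
      mul_le_mul_of_nonneg_left hmN' (by positivity)
    have h2 : 0 < (N : ℝ) * (5 * (m * (m - 1)) + 6 * (N - 1)) := by
      have : 0 ≤ (m : ℝ) * (m - 1) := mul_nonneg (by linarith) (by linarith)
      exact mul_pos hN0 (by linarith)
    nlinarith
  have hgap : ((m : ℝ) + 1) ^ 2 / (2 * N)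
      - ((((m : ℝ) * (m + 1) / 2) ^ 2 - m * (m + 1) * (2 * m + 1) / 6
        - m * (m + 1) * (2 * m + 1) / 6 + N * (m * (m + 1) / 2)) / (N * (N - 1))
        - (m * (m + 1) / (2 * N)) ^ 2)
      = (m + 1) * (6 * N ^ 2 + 4 * N * m * (2 * m + 1)
        - (3 * (m + 1) * m ^ 2 + 6 * (m + 1) * N)) / (12 * N ^ 2 * (N - 1)) := by
    have := hN1.ne'
    field_simp
    ring
  rw [← sub_pos, hgap]
  exact div_pos (mul_pos (by positivity) (sub_pos.2 hpoly)) (by positivity)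
end
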